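/- Assume d(n) → ∞ and (n − d)/√d → ρ for some fixed ρ ∈ [0,∞). Then 2^{n−d}·d·I(n,d,−1,1) → √(2π)·e^{ρ²/π} as n → ∞, and for every fixed r ∈ ℝ, 2^{n−d}·d·I(n,d,−1, r/d) → √(2π)·e^{ρ²/π}·Φ(r − ρ√(2/π)). -/

import Mathlib

open Filter

noncomputable def c1 (d : ℕ) : ℝ :=
  Real.Gamma ((d : ℝ) / 2) / (Real.sqrt Real.pi * Real.Gamma (((d : ℝ) - 1) / 2))

noncomputable def c2 (d : ℕ) : ℝ :=
  Real.Gamma (((d : ℝ) ^ 2 - 2 * (d : ℝ) + 2) / 2) /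
    (Real.sqrt Real.pi * Real.Gamma (((d : ℝ) ^ 2 - 2 * (d : ℝ) + 1) / 2))

/-- `II n d a b` is the integral `I(n,d,a,b)` from the paper. -/
noncomputable def II (n d : ℕ) (a b : ℝ) : ℝ :=
  ∫ h in a..b, (1 - h ^ 2) ^ (((d : ℝ) ^ 2 - 2 * (d : ℝ) - 1) / 2) *
    (c1 d * ∫ s in (-1 : ℝ)..h, (1 - s ^ 2) ^ (((d : ℝ) - 3) / 2)) ^ (n - d)

/-- `FF n d a b` is the expected number of facets with height in `[a,b]`. -/
noncomputable def FF (n d : ℕ) (a b : ℝ) : ℝ :=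
  (n.choose d : ℝ) * 2 * c2 d * II n d a b

/-- The standard normal CDF. -/
noncomputable def stdPhi (r : ℝ) : ℝ :=
  (Real.sqrt (2 * Real.pi))⁻¹ * ∫ s in Set.Iic r, Real.exp (-s ^ 2 / 2)

open MeasureTheory Topology

lemma continuous_one_sub_sq_rpow {q : ℝ} (hq : 0 ≤ q) :
    Continuous fun s : ℝ => (1 - s ^ 2) ^ q :=
  Continuous.rpow_const (by fun_prop) fun _ => Or.inr hq

lemma integral_rpow_mul_one_sub_rpow {a : ℝ} (ha : 0 < a) :
    ∫ t in (0 : ℝ)..1, t ^ (a - 1) * (1 - t) ^ (a - 1) =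
      Real.Gamma a * Real.Gamma a / Real.Gamma (a + a) := by
  have h := ProbabilityTheory.beta_eq_betaIntegralReal a a ha ha
  rw [ProbabilityTheory.beta] at h
  rw [h, Complex.betaIntegral, ← Complex.ofReal_re (∫ t in (0 : ℝ)..1, _),
    ← intervalIntegral.integral_ofReal]
  congr 1
  refine intervalIntegral.integral_congr fun t ht => ?_
  rw [Set.uIcc_of_le zero_le_one] at ht
  simp only [Complex.ofReal_mul]
  rw [Complex.ofReal_cpow ht.1, Complex.ofReal_cpow (sub_nonneg.2 ht.2)]
  push_cast
  rfl

lemma integral_one_sub_sq_rpow {q : ℝ} (hq : 0 ≤ q) :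
    ∫ s in (-1 : ℝ)..1, (1 - s ^ 2) ^ q =
      Real.sqrt Real.pi * Real.Gamma (q + 1) / Real.Gamma (q + 1 + 1 / 2) := by
  have h1 := intervalIntegral.integral_comp_mul_add (a := 0) (b := 1)
    (fun s : ℝ => (1 - s ^ 2) ^ q) (two_ne_zero) (-1)
  have h2 : ∫ t in (0 : ℝ)..1, (1 - (2 * t + -1) ^ 2) ^ q =
      4 ^ q * ∫ t in (0 : ℝ)..1, t ^ (q + 1 - 1) * (1 - t) ^ (q + 1 - 1) := by
    rw [← intervalIntegral.integral_const_mul]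
    refine intervalIntegral.integral_congr fun t ht => ?_
    rw [Set.uIcc_of_le zero_le_one] at ht
    have ht1 : 0 ≤ 1 - t := sub_nonneg.2 ht.2
    simp only [add_sub_cancel_right]
    rw [← Real.mul_rpow ht.1 ht1, ← Real.mul_rpow (by norm_num) (mul_nonneg ht.1 ht1)]
    congr 1
    ring
  rw [h2, integral_rpow_mul_one_sub_rpow (by linarith)] at h1
  norm_num at h1
  have h3 := Real.Gamma_mul_Gamma_add_half (q + 1)
  have h4 : (4 : ℝ) ^ q * 2 ^ (1 - 2 * (q + 1)) = 1 / 2 := by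
    rw [show (4 : ℝ) = 2 ^ (2 : ℝ) by norm_num, ← Real.rpow_mul (by norm_num),
      ← Real.rpow_add (by norm_num), show 2 * q + (1 - 2 * (q + 1)) = (-1 : ℝ) by ring,
      Real.rpow_neg_one]
    norm_num
  have h5 : 0 < Real.Gamma (q + 1 + 1 / 2) := Real.Gamma_pos_of_pos (by linarith)
  have h6 : 0 < Real.Gamma (2 * (q + 1)) := Real.Gamma_pos_of_pos (by linarith)
  have h7 : 0 < Real.Gamma (q + 1) := Real.Gamma_pos_of_pos (by linarith)
  rw [← two_mul] at h1
  rw [eq_div_iff h5.ne']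
  have h8 : ∫ s in (-1 : ℝ)..1, (1 - s ^ 2) ^ q =
    2 * (4 ^ q * (Real.Gamma (q + 1) * Real.Gamma (q + 1) / Real.Gamma (2 * (q + 1)))) := by
    rw [h1]; ring
  rw [h8]
  generalize Real.Gamma (q + 1 + 1 / 2) = z at *
  field_simp
  rw [mul_assoc, h3]
  linear_combination 2 * Real.Gamma (2 * (q + 1)) * Real.sqrt Real.pi * h4

lemma c1_mul_integral_neg_one_zero {d : ℕ} (hd : 3 ≤ d) :
    c1 d * ∫ s in (-1 : ℝ)..0, (1 - s ^ 2) ^ (((d : ℝ) - 3) / 2) = 1 / 2 := by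
  have hd' : (3 : ℝ) ≤ d := by exact_mod_cast hd
  have hq : 0 ≤ ((d : ℝ) - 3) / 2 := by linarith
  have hc := continuous_one_sub_sq_rpow hq
  have h1 := integral_one_sub_sq_rpow hq
  have h2 := intervalIntegral.integral_comp_neg (a := -1) (b := 0)
    (fun s : ℝ => (1 - s ^ 2) ^ (((d : ℝ) - 3) / 2))
  simp only [neg_sq, neg_zero, neg_neg] at h2
  rw [← intervalIntegral.integral_add_adjacent_intervals (b := 0)
    (hc.intervalIntegrable _ _) (hc.intervalIntegrable _ _), ← h2,
    show ((d : ℝ) - 3) / 2 + 1 = (d - 1) / 2 by ring,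
    show ((d : ℝ) - 1) / 2 + 1 / 2 = d / 2 by ring] at h1
  have h5 : 0 < Real.Gamma ((d : ℝ) / 2) := Real.Gamma_pos_of_pos (by linarith)
  have h6 : 0 < Real.Gamma (((d : ℝ) - 1) / 2) := Real.Gamma_pos_of_pos (by linarith)
  have h7 : 0 < Real.sqrt Real.pi := Real.sqrt_pos.2 Real.pi_pos
  rw [c1]
  rw [eq_div_iff h5.ne'] at h1
  field_simp
  linarith

lemma c1_nonneg {d : ℕ} (hd : 3 ≤ d) : 0 ≤ c1 d := by
  have hd' : (3 : ℝ) ≤ d := by exact_mod_cast hd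
  have h5 : 0 < Real.Gamma ((d : ℝ) / 2) := Real.Gamma_pos_of_pos (by linarith)
  have h6 : 0 < Real.Gamma (((d : ℝ) - 1) / 2) := Real.Gamma_pos_of_pos (by linarith)
  rw [c1]
  positivity

lemma Gamma_add_half_sq_le {x : ℝ} (hx : 0 < x) :
    Real.Gamma (x + 1 / 2) ^ 2 ≤ x * Real.Gamma x ^ 2 := by
  have h := Real.Gamma_mul_add_mul_le_rpow_Gamma_mul_rpow_Gamma (s := x) (t := x + 1)
    (a := 1 / 2) (b := 1 / 2) hx (by linarith) (by norm_num) (by norm_num) (by norm_num)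
  have hx0 := Real.Gamma_pos_of_pos hx
  have hx1 : 0 < Real.Gamma (x + 1 / 2) := Real.Gamma_pos_of_pos (by linarith)
  rw [show 1 / 2 * x + 1 / 2 * (x + 1) = x + 1 / 2 by ring, Real.Gamma_add_one hx.ne',
    ← Real.mul_rpow hx0.le (by positivity), ← Real.sqrt_eq_rpow] at h
  calc _ ≤ Real.sqrt (Real.Gamma x * (x * Real.Gamma x)) ^ 2 := by gcongr
    _ = _ := by rw [Real.sq_sqrt (by positivity)]; ring

lemma c1_sq_mul_pi_bounds {d : ℕ} (hd : 3 ≤ d) :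
    ((d : ℝ) - 2) / 2 ≤ c1 d ^ 2 * Real.pi ∧ c1 d ^ 2 * Real.pi ≤ ((d : ℝ) - 1) / 2 := by
  have hd' : (3 : ℝ) ≤ d := by exact_mod_cast hd
  have h6 : 0 < Real.Gamma (((d : ℝ) - 1) / 2) := Real.Gamma_pos_of_pos (by linarith)
  have h7 : 0 < Real.Gamma (((d : ℝ) - 2) / 2) := Real.Gamma_pos_of_pos (by linarith)
  have hu := Gamma_add_half_sq_le (x := ((d : ℝ) - 1) / 2) (by linarith)
  have hl := Gamma_add_half_sq_le (x := ((d : ℝ) - 2) / 2) (by linarith)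
  have hr := Real.Gamma_add_one (s := ((d : ℝ) - 2) / 2) (by linarith)
  rw [show ((d : ℝ) - 1) / 2 + 1 / 2 = d / 2 by ring] at hu
  rw [show ((d : ℝ) - 2) / 2 + 1 / 2 = (d - 1) / 2 by ring] at hl
  rw [show ((d : ℝ) - 2) / 2 + 1 = d / 2 by ring] at hr
  have he : c1 d ^ 2 * Real.pi =
      Real.Gamma ((d : ℝ) / 2) ^ 2 / Real.Gamma (((d : ℝ) - 1) / 2) ^ 2 := by
    rw [c1, div_pow, mul_pow, Real.sq_sqrt Real.pi_pos.le]
    field_simp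
  rw [he]
  refine ⟨?_, (div_le_iff₀ (by positivity)).2 hu⟩
  rw [le_div_iff₀ (by positivity), hr]
  have := mul_le_mul_of_nonneg_left hl (show 0 ≤ ((d : ℝ) - 2) / 2 by linarith)
  linarith

lemma tendsto_c1_div_sqrt :
    Tendsto (fun d : ℕ => c1 d / Real.sqrt d) atTop (𝓝 (Real.sqrt (1 / (2 * Real.pi)))) := by
  have hpi := Real.pi_pos
  have hinv : Tendsto (fun d : ℕ => ((d : ℝ))⁻¹) atTop (𝓝 0) := tendsto_inv_atTop_nhds_zero_nat
  have h1 : Tendsto (fun d : ℕ => (1 - 2 * ((d : ℝ))⁻¹) / (2 * Real.pi)) atTop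
      (𝓝 (1 / (2 * Real.pi))) := by
    simpa using ((hinv.const_mul 2).const_sub 1).div_const (2 * Real.pi)
  have h2 : Tendsto (fun d : ℕ => (1 - ((d : ℝ))⁻¹) / (2 * Real.pi)) atTop
      (𝓝 (1 / (2 * Real.pi))) := by
    simpa using (hinv.const_sub 1).div_const (2 * Real.pi)
  have h3 : Tendsto (fun d : ℕ => c1 d ^ 2 / d) atTop (𝓝 (1 / (2 * Real.pi))) := by
    refine tendsto_of_tendsto_of_tendsto_of_le_of_le' h1 h2 ?_ ?_
    · filter_upwards [eventually_ge_atTop 3] with d hd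
      have hd' : (3 : ℝ) ≤ d := by exact_mod_cast hd
      have := (c1_sq_mul_pi_bounds hd).1
      have hd0 : (0 : ℝ) < d := by linarith
      rw [div_le_div_iff₀ (by positivity) hd0, sub_mul, mul_assoc, inv_mul_cancel₀ hd0.ne']
      linarith
    · filter_upwards [eventually_ge_atTop 3] with d hd
      have hd' : (3 : ℝ) ≤ d := by exact_mod_cast hd
      have := (c1_sq_mul_pi_bounds hd).2
      have hd0 : (0 : ℝ) < d := by linarith
      rw [div_le_div_iff₀ hd0 (by positivity), sub_mul, inv_mul_cancel₀ hd0.ne']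
      linarith
  refine h3.sqrt.congr' ?_
  filter_upwards [eventually_ge_atTop 3] with d hd
  rw [Real.sqrt_div (sq_nonneg _), Real.sqrt_sq (c1_nonneg hd)]

lemma tendsto_one_add_rpow_of_tendsto_mul {ι : Type*} {l : Filter ι} {y p : ι → ℝ} {L : ℝ}
    (hy : Tendsto y l (𝓝 0)) (hpy : Tendsto (fun i => p i * y i) l (𝓝 L)) (hp : ∀ᶠ i in l, 0 ≤ p i) :
    Tendsto (fun i => (1 + y i) ^ p i) l (𝓝 (Real.exp L)) := by
  have hpos : ∀ᶠ i in l, 0 < 1 + y i := by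
    filter_upwards [hy.eventually_const_lt (show (-1 : ℝ) < 0 by norm_num)] with i hi
    linarith
  have h1 : Tendsto (fun i => p i * y i / (1 + y i)) l (𝓝 L) := by
    simpa [Pi.div_def] using hpy.div (hy.const_add 1) (by norm_num)
  have hlog : Tendsto (fun i => Real.log (1 + y i) * p i) l (𝓝 L) := by
    refine tendsto_of_tendsto_of_tendsto_of_le_of_le' h1 hpy ?_ ?_
    · filter_upwards [hpos, hp] with i hi hpi
      have := Real.one_sub_inv_le_log_of_pos hi
      have he : y i / (1 + y i) = 1 - (1 + y i)⁻¹ := by field_simp; ring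
      rw [mul_div_assoc, he, mul_comm]
      gcongr
    · filter_upwards [hpos, hp] with i hi hpi
      have := Real.log_le_sub_one_of_pos hi
      rw [mul_comm (p i)]
      gcongr
      linarith
  refine ((Real.continuous_exp.tendsto L).comp hlog).congr' ?_
  filter_upwards [hpos] with i hi
  rw [Function.comp, Real.rpow_def_of_pos hi]

lemma integrable_exp_neg_sq_div_two_add_mul (μ : ℝ) :
    Integrable fun x : ℝ => Real.exp (-x ^ 2 / 2 + μ * x) := by
  have h := ((integrable_exp_neg_mul_sq (b := 1 / 2) (by norm_num)).comp_sub_right μ).const_mul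
    (Real.exp (μ ^ 2 / 2))
  refine h.congr (Eventually.of_forall fun x => ?_)
  simp only [← Real.exp_add]
  congr 1
  ring

lemma integral_exp_neg_sq_div_two_add_mul (μ : ℝ) :
    ∫ x : ℝ, Real.exp (-x ^ 2 / 2 + μ * x) = Real.sqrt (2 * Real.pi) * Real.exp (μ ^ 2 / 2) := by
  have h := integral_gaussian (1 / 2)
  rw [← integral_sub_right_eq_self _ μ, show Real.pi / (1 / 2) = 2 * Real.pi by ring] at h
  rw [← h, mul_comm, ← integral_const_mul]
  congr with x
  rw [← Real.exp_add]
  congr 1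
  ring

lemma setIntegral_Iic_exp_neg_sq_div_two_add_mul (μ r : ℝ) :
    ∫ x in Set.Iic r, Real.exp (-x ^ 2 / 2 + μ * x) =
      Real.sqrt (2 * Real.pi) * Real.exp (μ ^ 2 / 2) * stdPhi (r - μ) := by
  have hs : Real.sqrt (2 * Real.pi) ≠ 0 := (Real.sqrt_pos.2 (by positivity)).ne'
  have h1 : stdPhi (r - μ) = (Real.sqrt (2 * Real.pi))⁻¹ *
      ∫ x in Set.Iic r, Real.exp (-(x - μ) ^ 2 / 2) := by
    rw [stdPhi, ← integral_indicator measurableSet_Iic, ← integral_indicator measurableSet_Iic,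
      ← integral_sub_right_eq_self _ μ]
    congr 2 with x
    simp [Set.indicator]
  rw [h1, mul_comm (Real.sqrt _), mul_assoc, mul_inv_cancel_left₀ hs, ← integral_const_mul]
  congr with x
  rw [← Real.exp_add]
  congr 1
  ring

/-- The deviation of twice the spherical cap probability at height `h` from `1`. -/
noncomputable def capExcess (d : ℕ) (h : ℝ) : ℝ :=
  2 * c1 d * ∫ s in (0 : ℝ)..h, (1 - s ^ 2) ^ (((d : ℝ) - 3) / 2)

/-- The integrand of `II` after rescaling by `d`, with the factor `2 ^ (n - d)` absorbed. -/
noncomputable def rescaledIntegrand (n d : ℕ) (x : ℝ) : ℝ :=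
  (1 - (x / d) ^ 2) ^ (((d : ℝ) ^ 2 - 2 * (d : ℝ) - 1) / 2) * (1 + capExcess d (x / d)) ^ (n - d)

lemma two_mul_c1_mul_integral {d : ℕ} (hd : 3 ≤ d) (h : ℝ) :
    2 * (c1 d * ∫ s in (-1 : ℝ)..h, (1 - s ^ 2) ^ (((d : ℝ) - 3) / 2)) = 1 + capExcess d h := by
  have hd' : (3 : ℝ) ≤ d := by exact_mod_cast hd
  have hc := continuous_one_sub_sq_rpow (show 0 ≤ ((d : ℝ) - 3) / 2 by linarith)
  rw [← intervalIntegral.integral_add_adjacent_intervals (b := 0)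
    (hc.intervalIntegrable _ _) (hc.intervalIntegrable _ _), capExcess, mul_add,
    c1_mul_integral_neg_one_zero hd]
  ring

lemma continuous_capExcess {d : ℕ} (hd : 3 ≤ d) : Continuous (capExcess d) := by
  have hd' : (3 : ℝ) ≤ d := by exact_mod_cast hd
  have hc := continuous_one_sub_sq_rpow (show 0 ≤ ((d : ℝ) - 3) / 2 by linarith)
  exact (intervalIntegral.continuous_primitive (fun _ _ => hc.intervalIntegrable _ _) 0).const_mul _

lemma continuous_rescaledIntegrand (n : ℕ) {d : ℕ} (hd : 3 ≤ d) :
    Continuous (rescaledIntegrand n d) := by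
  have hd' : (3 : ℝ) ≤ d := by exact_mod_cast hd
  have h1 := continuous_one_sub_sq_rpow
    (show 0 ≤ ((d : ℝ) ^ 2 - 2 * (d : ℝ) - 1) / 2 by nlinarith)
  have h2 := continuous_capExcess hd
  have h3 : Continuous fun x : ℝ => x / (d : ℝ) := by fun_prop
  exact (h1.comp h3).mul ((continuous_const.add (h2.comp h3)).pow _)

lemma two_pow_mul_mul_II (n : ℕ) {d : ℕ} (hd : 3 ≤ d) (a b : ℝ) :
    (2 : ℝ) ^ (n - d) * d * II n d (a / d) (b / d) = ∫ x in a..b, rescaledIntegrand n d x := by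
  have hd0 : (d : ℝ) ≠ 0 := by positivity
  have h := intervalIntegral.integral_comp_div (a := a) (b := b) (fun h : ℝ =>
    (1 - h ^ 2) ^ (((d : ℝ) ^ 2 - 2 * (d : ℝ) - 1) / 2) * (1 + capExcess d h) ^ (n - d)) hd0
  simp only [rescaledIntegrand]
  rw [h, smul_eq_mul, mul_comm ((2 : ℝ) ^ _), mul_assoc, II, ← intervalIntegral.integral_const_mul]
  congr 2 with x
  rw [← two_mul_c1_mul_integral hd, mul_pow 2]
  ring

lemma abs_capExcess_le {d : ℕ} (hd : 3 ≤ d) {h : ℝ} (hh : |h| ≤ 1) :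
    |capExcess d h| ≤ 2 * c1 d * |h| := by
  have hd' : (3 : ℝ) ≤ d := by exact_mod_cast hd
  have hc := c1_nonneg hd
  rw [capExcess, abs_mul, abs_of_nonneg (by positivity : 0 ≤ 2 * c1 d)]
  refine mul_le_mul_of_nonneg_left ?_ (by positivity)
  have := intervalIntegral.norm_integral_le_of_norm_le_const (a := 0) (b := h) (C := 1)
    (f := fun s : ℝ => (1 - s ^ 2) ^ (((d : ℝ) - 3) / 2)) fun s hs => by
      have hs2 : s ^ 2 ≤ 1 := by
        rw [sq_le_one_iff_abs_le_one]
        have := Set.abs_sub_left_of_mem_uIcc (Set.uIoc_subset_uIcc hs)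
        simp only [sub_zero] at this
        exact this.trans hh
      rw [Real.norm_of_nonneg (Real.rpow_nonneg (by linarith) _)]
      exact Real.rpow_le_one (by linarith) (by nlinarith) (by linarith)
  simpa using this

lemma abs_capExcess_sub_le {d : ℕ} (hd : 5 ≤ d) {h : ℝ} (hh : |h| ≤ 1) :
    |capExcess d h - 2 * c1 d * h| ≤ c1 d * d * |h| ^ 3 := by
  have hd' : (5 : ℝ) ≤ d := by exact_mod_cast hd
  have hc := c1_nonneg (show 3 ≤ d by omega)
  have hcont := continuous_one_sub_sq_rpow (show 0 ≤ ((d : ℝ) - 3) / 2 by linarith)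
  have key : |(∫ s in (0 : ℝ)..h, (1 - s ^ 2) ^ (((d : ℝ) - 3) / 2)) - h| ≤
      (d / 2 * h ^ 2) * |h| := by
    have h1 : (∫ s in (0 : ℝ)..h, (1 - s ^ 2) ^ (((d : ℝ) - 3) / 2)) - h =
        ∫ s in (0 : ℝ)..h, ((1 - s ^ 2) ^ (((d : ℝ) - 3) / 2) - 1) := by
      rw [intervalIntegral.integral_sub (hcont.intervalIntegrable _ _) (by simp)]
      simp
    rw [h1]
    have := intervalIntegral.norm_integral_le_of_norm_le_const (a := 0) (b := h)
      (C := d / 2 * h ^ 2)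
      (f := fun s : ℝ => (1 - s ^ 2) ^ (((d : ℝ) - 3) / 2) - 1) fun s hs => by
        have hsh : |s| ≤ |h| := by
          have := Set.abs_sub_left_of_mem_uIcc (Set.uIoc_subset_uIcc hs)
          simpa only [sub_zero] using this
        have hs2 : s ^ 2 ≤ 1 := (sq_le_one_iff_abs_le_one s).2 (hsh.trans hh)
        have hs3 : s ^ 2 ≤ h ^ 2 := sq_le_sq.2 hsh
        have hb := one_add_mul_self_le_rpow_one_add (s := -s ^ 2) (by linarith)
          (p := ((d : ℝ) - 3) / 2) (by linarith)
        have hu := Real.rpow_le_one (x := 1 - s ^ 2) (z := ((d : ℝ) - 3) / 2)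
          (by linarith) (by nlinarith) (by linarith)
        rw [← sub_eq_add_neg] at hb
        rw [Real.norm_eq_abs, abs_sub_comm, abs_of_nonneg (by linarith)]
        nlinarith [sq_nonneg s]
    simpa using this
  rw [capExcess, ← mul_sub, abs_mul, abs_of_nonneg (by positivity : 0 ≤ 2 * c1 d)]
  calc _ ≤ 2 * c1 d * ((d / 2 * h ^ 2) * |h|) := by gcongr
    _ = _ := by rw [← sq_abs]; ring

lemma abs_rescaledIntegrand_le {n d : ℕ} (hd : 5 ≤ d) {K x : ℝ}
    (hK : 2 * c1 d * ((n - d : ℕ) : ℝ) / d ≤ K) (hx : |x| ≤ d) :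
    |rescaledIntegrand n d x| ≤ Real.exp (2 * K ^ 2) * Real.exp (-(1 / 8) * x ^ 2) := by
  have hd' : (5 : ℝ) ≤ d := by exact_mod_cast hd
  have hd0 : (0 : ℝ) < d := by linarith
  have hc := c1_nonneg (show 3 ≤ d by omega)
  have hh : |x / d| ≤ 1 := by
    rw [abs_div, abs_of_pos hd0]
    exact (div_le_one hd0).2 hx
  have hh2 : (x / d) ^ 2 ≤ 1 := (sq_le_one_iff_abs_le_one _).2 hh
  have h1 : |(1 - (x / d) ^ 2) ^ (((d : ℝ) ^ 2 - 2 * (d : ℝ) - 1) / 2)| ≤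
      Real.exp (-(1 / 4) * x ^ 2) := by
    rw [abs_of_nonneg (Real.rpow_nonneg (by linarith) _)]
    calc (1 - (x / d) ^ 2) ^ (((d : ℝ) ^ 2 - 2 * (d : ℝ) - 1) / 2)
        ≤ Real.exp (-(x / d) ^ 2) ^ (((d : ℝ) ^ 2 - 2 * (d : ℝ) - 1) / 2) := by
          refine Real.rpow_le_rpow (by linarith) ?_ (by nlinarith)
          linarith [Real.add_one_le_exp (-(x / d) ^ 2)]
      _ = Real.exp (-(x / d) ^ 2 * (((d : ℝ) ^ 2 - 2 * (d : ℝ) - 1) / 2)) := by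
          rw [← Real.exp_mul]
      _ ≤ _ := by
          rw [Real.exp_le_exp]
          have h2 : x ^ 2 = (x / d) ^ 2 * d ^ 2 := by field_simp
          rw [h2]
          nlinarith [mul_nonneg (sq_nonneg (x / d)) (show 0 ≤ (d : ℝ) ^ 2 - 4 * d - 2 by nlinarith)]
  have h2 : |(1 + capExcess d (x / d)) ^ (n - d)| ≤ Real.exp (K * |x|) := by
    rw [abs_pow]
    calc |1 + capExcess d (x / d)| ^ (n - d)
        ≤ Real.exp (2 * c1 d * |x / d|) ^ (n - d) := by
          gcongr
          calc _ ≤ |(1 : ℝ)| + |capExcess d (x / d)| := abs_add_le _ _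
            _ ≤ 1 + 2 * c1 d * |x / d| := by
              rw [abs_one]
              gcongr
              exact abs_capExcess_le (by omega) hh
            _ ≤ _ := by linarith [Real.add_one_le_exp (2 * c1 d * |x / d|)]
      _ = Real.exp ((2 * c1 d * ((n - d : ℕ) : ℝ) / d) * |x|) := by
          rw [← Real.exp_nat_mul, abs_div, abs_of_pos hd0]
          congr 1
          ring
      _ ≤ _ := by gcongr
  rw [rescaledIntegrand, abs_mul]
  calc _ ≤ Real.exp (-(1 / 4) * x ^ 2) * Real.exp (K * |x|) := by gcongr
    _ ≤ _ := by
      rw [← Real.exp_add, ← Real.exp_add, Real.exp_le_exp]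
      nlinarith [sq_nonneg (|x| - 4 * K), sq_abs x]

section Limits

variable {d : ℕ → ℕ} {ρ : ℝ}

lemma tendsto_two_mul_c1_mul_div (hd : ∀ᶠ n in atTop, d n ≤ n) (hdi : Tendsto d atTop atTop)
    (hreg : Tendsto (fun n : ℕ => ((n : ℝ) - (d n : ℝ)) / Real.sqrt (d n)) atTop (𝓝 ρ)) :
    Tendsto (fun n : ℕ => 2 * c1 (d n) * ((n - d n : ℕ) : ℝ) / d n) atTop
      (𝓝 (ρ * Real.sqrt (2 / Real.pi))) := by
  have h := ((tendsto_c1_div_sqrt.comp hdi).const_mul 2).mul hreg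
  have he : 2 * Real.sqrt (1 / (2 * Real.pi)) * ρ = ρ * Real.sqrt (2 / Real.pi) := by
    have h4 : (2 : ℝ) = Real.sqrt 4 := by
      rw [show (4 : ℝ) = 2 ^ 2 by norm_num, Real.sqrt_sq (by norm_num)]
    rw [mul_comm ρ]
    congr 1
    nth_rw 1 [h4]
    rw [← Real.sqrt_mul (by norm_num)]
    congr 1
    field_simp
    norm_num
  rw [he] at h
  refine h.congr' ?_
  filter_upwards [hd] with n hn
  simp only [Function.comp]
  have hsq : ((d n : ℝ))⁻¹ = (Real.sqrt (d n))⁻¹ * (Real.sqrt (d n))⁻¹ := by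
    rw [← mul_inv, Real.mul_self_sqrt (Nat.cast_nonneg _)]
  rw [Nat.cast_sub hn, div_eq_mul_inv _ ((d n : ℝ)), hsq]
  ring

lemma tendsto_c1_div (hdi : Tendsto d atTop atTop) :
    Tendsto (fun n : ℕ => c1 (d n) / d n) atTop (𝓝 0) := by
  have h : Tendsto (fun k : ℕ => c1 k / k) atTop (𝓝 0) := by
    have h1 : Tendsto (fun k : ℕ => (Real.sqrt (k : ℝ))⁻¹) atTop (𝓝 0) :=
      (Real.tendsto_sqrt_atTop.comp tendsto_natCast_atTop_atTop).inv_tendsto_atTop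
    have h2 := tendsto_c1_div_sqrt.mul h1
    rw [mul_zero] at h2
    refine h2.congr fun k => ?_
    nth_rw 3 [← Real.mul_self_sqrt (Nat.cast_nonneg k)]
    ring
  exact h.comp hdi

lemma tendsto_rescaledIntegrand (hd : ∀ᶠ n in atTop, d n ≤ n) (hdi : Tendsto d atTop atTop)
    (hreg : Tendsto (fun n : ℕ => ((n : ℝ) - (d n : ℝ)) / Real.sqrt (d n)) atTop (𝓝 ρ)) (x : ℝ) :
    Tendsto (fun n => rescaledIntegrand n (d n) x) atTop
      (𝓝 (Real.exp (-x ^ 2 / 2 + ρ * Real.sqrt (2 / Real.pi) * x))) := by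
  have hdr : Tendsto (fun n => (d n : ℝ)) atTop atTop := tendsto_natCast_atTop_atTop.comp hdi
  have hinv : Tendsto (fun n => ((d n : ℝ))⁻¹) atTop (𝓝 0) := hdr.inv_tendsto_atTop
  have hxd : Tendsto (fun n => x / (d n : ℝ)) atTop (𝓝 0) := by
    simpa [div_eq_mul_inv] using hinv.const_mul x
  have hd5 : ∀ᶠ n in atTop, 5 ≤ d n := hdi.eventually_ge_atTop 5
  have hsmall : ∀ᶠ n in atTop, |x / (d n : ℝ)| ≤ 1 := by
    have := hxd.abs
    rw [abs_zero] at this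
    exact this.eventually_le_const one_pos
  have hc := tendsto_two_mul_c1_mul_div hd hdi hreg
  rw [Real.exp_add]
  refine Tendsto.mul ?_ ?_
  · refine tendsto_one_add_rpow_of_tendsto_mul (y := fun n => -(x / (d n : ℝ)) ^ 2) ?_ ?_ ?_
    · simpa using (hxd.pow 2).neg
    · have h1 : Tendsto (fun n => (1 - 2 * ((d n : ℝ))⁻¹ - ((d n : ℝ))⁻¹ ^ 2) * (-x ^ 2 / 2)) atTop
          (𝓝 (-x ^ 2 / 2)) := by
        simpa using (((hinv.const_mul 2).const_sub 1).sub (hinv.pow 2)).mul_const (-x ^ 2 / 2)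
      refine h1.congr' ?_
      filter_upwards [hd5] with n hn
      have : (d n : ℝ) ≠ 0 := by positivity
      field_simp
    · filter_upwards [hd5] with n hn
      have : (5 : ℝ) ≤ d n := by exact_mod_cast hn
      nlinarith
  · simp only [← Real.rpow_natCast]
    refine tendsto_one_add_rpow_of_tendsto_mul ?_ ?_ (Eventually.of_forall fun _ => Nat.cast_nonneg _)
    · have h1 : Tendsto (fun n => 2 * |x| * (c1 (d n) / d n)) atTop (𝓝 0) := by
        simpa using (tendsto_c1_div hdi).const_mul (2 * |x|)
      refine squeeze_zero_norm' ?_ h1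
      filter_upwards [hd5, hsmall] with n hn hs
      refine (abs_capExcess_le (by omega) hs).trans_eq ?_
      rw [abs_div, Nat.abs_cast]
      ring
    · have h1 : Tendsto (fun n => 2 * c1 (d n) * ((n - d n : ℕ) : ℝ) / d n * x) atTop
          (𝓝 (ρ * Real.sqrt (2 / Real.pi) * x)) := hc.mul_const x
      have h2 : Tendsto (fun n => ((n - d n : ℕ) : ℝ) * capExcess (d n) (x / d n) -
          2 * c1 (d n) * ((n - d n : ℕ) : ℝ) / d n * x) atTop (𝓝 0) := by
        have h3 : Tendsto (fun n => 2 * c1 (d n) * ((n - d n : ℕ) : ℝ) / d n *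
            ((|x| ^ 3 / 2) * ((d n : ℝ))⁻¹)) atTop (𝓝 0) := by
          simpa using hc.mul (hinv.const_mul (|x| ^ 3 / 2))
        refine squeeze_zero_norm' ?_ h3
        filter_upwards [hd5, hsmall] with n hn hs
        have h0 : (d n : ℝ) ≠ 0 := by positivity
        have h4 : ((n - d n : ℕ) : ℝ) * capExcess (d n) (x / d n) -
            2 * c1 (d n) * ((n - d n : ℕ) : ℝ) / d n * x =
            ((n - d n : ℕ) : ℝ) * (capExcess (d n) (x / d n) - 2 * c1 (d n) * (x / d n)) := by
          ring
        rw [h4, Real.norm_eq_abs, abs_mul, Nat.abs_cast]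
        calc _ ≤ ((n - d n : ℕ) : ℝ) * (c1 (d n) * d n * |x / d n| ^ 3) := by
              gcongr
              exact abs_capExcess_sub_le hn hs
          _ = _ := by
              rw [abs_div, Nat.abs_cast]
              field_simp
      simpa using h2.add h1

lemma tendsto_setIntegral_rescaledIntegrand (hd : ∀ᶠ n in atTop, d n ≤ n)
    (hdi : Tendsto d atTop atTop)
    (hreg : Tendsto (fun n : ℕ => ((n : ℝ) - (d n : ℝ)) / Real.sqrt (d n)) atTop (𝓝 ρ))
    (S : Set ℝ) :
    Tendsto (fun n => ∫ x in S, (Set.Ioc (-(d n : ℝ)) (d n)).indicator (rescaledIntegrand n (d n)) x)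
      atTop (𝓝 (∫ x in S, Real.exp (-x ^ 2 / 2 + ρ * Real.sqrt (2 / Real.pi) * x))) := by
  have hdr : Tendsto (fun n => (d n : ℝ)) atTop atTop := tendsto_natCast_atTop_atTop.comp hdi
  have hd5 : ∀ᶠ n in atTop, 5 ≤ d n := hdi.eventually_ge_atTop 5
  set K := ρ * Real.sqrt (2 / Real.pi) + 1 with hK
  have hKev := (tendsto_two_mul_c1_mul_div hd hdi hreg).eventually_le_const
    (show ρ * Real.sqrt (2 / Real.pi) < K by linarith)
  refine tendsto_integral_filter_of_dominated_convergence
    (fun x => Real.exp (2 * K ^ 2) * Real.exp (-(1 / 8) * x ^ 2)) ?_ ?_ ?_ ?_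
  · filter_upwards [hd5] with n hn
    exact ((continuous_rescaledIntegrand n (by omega)).measurable.indicator
      measurableSet_Ioc).aestronglyMeasurable
  · filter_upwards [hd5, hKev] with n hn hk
    refine Eventually.of_forall fun x => ?_
    by_cases hx : x ∈ Set.Ioc (-(d n : ℝ)) (d n)
    · rw [Set.indicator_of_mem hx]
      exact abs_rescaledIntegrand_le hn hk (abs_le.2 ⟨hx.1.le, hx.2⟩)
    · rw [Set.indicator_of_notMem hx, norm_zero]
      positivity
  · exact ((integrable_exp_neg_mul_sq (by norm_num)).const_mul _).integrableOn
  · refine Eventually.of_forall fun x => ?_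
    refine (tendsto_rescaledIntegrand hd hdi hreg x).congr' ?_
    filter_upwards [hdr.eventually_gt_atTop |x|] with n hn
    exact (Set.indicator_of_mem (Set.mem_Ioc.2 ⟨(abs_lt.1 hn).1, (abs_lt.1 hn).2.le⟩) _).symm

end Limits

/-- if `d → ∞` and `(n-d)/√d → ρ ∈ [0,∞)`, then
`2^{n-d}·d·I(n,d,-1,1) → √(2π)·e^{ρ²/π}` and
`2^{n-d}·d·I(n,d,-1,r/d) → √(2π)·e^{ρ²/π}·Φ(r - ρ√(2/π))`. -/
theorem I_asymptotics_sublinear (d : ℕ → ℕ) (ρ : ℝ) (hρ : 0 ≤ ρ)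
    (hd : ∀ᶠ n in atTop, 2 ≤ d n ∧ d n < n)
    (hdi : Tendsto (fun n : ℕ => (d n : ℝ)) atTop atTop)
    (hreg : Tendsto (fun n : ℕ => ((n : ℝ) - (d n : ℝ)) / Real.sqrt (d n)) atTop (nhds ρ)) :
    Tendsto (fun n : ℕ => (2 : ℝ) ^ (n - d n) * (d n : ℝ) * II n (d n) (-1) 1)
      atTop (nhds (Real.sqrt (2 * Real.pi) * Real.exp (ρ ^ 2 / Real.pi))) ∧
    ∀ r : ℝ,
      Tendsto (fun n : ℕ => (2 : ℝ) ^ (n - d n) * (d n : ℝ) * II n (d n) (-1) (r / (d n : ℝ)))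
        atTop
        (nhds (Real.sqrt (2 * Real.pi) * Real.exp (ρ ^ 2 / Real.pi) *
          stdPhi (r - ρ * Real.sqrt (2 / Real.pi)))) := by
  have hd' : ∀ᶠ n in atTop, d n ≤ n := hd.mono fun n hn => hn.2.le
  have hdi' : Tendsto d atTop atTop := tendsto_natCast_atTop_iff.1 hdi
  have hd3 : ∀ᶠ n in atTop, 3 ≤ d n := hdi'.eventually_ge_atTop 3
  have hμ : (ρ * Real.sqrt (2 / Real.pi)) ^ 2 / 2 = ρ ^ 2 / Real.pi := by
    rw [mul_pow, Real.sq_sqrt (by positivity)]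
    ring
  have key := tendsto_setIntegral_rescaledIntegrand hd' hdi' hreg
  constructor
  · have h := key Set.univ
    simp only [setIntegral_univ] at h
    rw [integral_exp_neg_sq_div_two_add_mul, hμ] at h
    refine h.congr' ?_
    filter_upwards [hd3] with n hn
    have hd0 : (d n : ℝ) ≠ 0 := by positivity
    have h1 := two_pow_mul_mul_II n hn (-(d n : ℝ)) (d n)
    rw [neg_div, div_self hd0] at h1
    rw [h1, integral_indicator measurableSet_Ioc,
      intervalIntegral.integral_of_le (neg_le_self (Nat.cast_nonneg _))]
  · intro r
    have h := key (Set.Iic r)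
    rw [setIntegral_Iic_exp_neg_sq_div_two_add_mul, hμ] at h
    refine h.congr' ?_
    filter_upwards [hd3, hdi.eventually_ge_atTop |r|] with n hn hr
    have hd0 : (d n : ℝ) ≠ 0 := by positivity
    have h1 := two_pow_mul_mul_II n hn (-(d n : ℝ)) r
    rw [neg_div, div_self hd0] at h1
    rw [h1, setIntegral_indicator measurableSet_Ioc,
      intervalIntegral.integral_of_le (neg_le_of_abs_le hr), Set.inter_comm, Set.Ioc_inter_Iic,
      min_eq_right (le_of_abs_le hr)]
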